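/- Let R be a commutative ring, A ∈ R^{n×n}, 0 < s < t < n, with δ_s and δ_t non-zero-divisors. Write the matrix A^{(s+1)}_n of bordered (s+1)-minors in block form [[Ā, C̄], [B̄, D̄]] where Ā is of size (t-s)×(t-s). Then δ_s · A^{(t+1)}_n = δ_t · D̄ − B̄ · adj(Ā) · C̄ · δ_s^{-(t-s-1)}, i.e. δ_s^{t-s} · A^{(t+1)}_n = δ_s^{t-s-1} δ_t D̄ − B̄ · adj(Ā) · C̄, where A^{(t+1)}_n is the matrix of bordered (t+1)-minors of A. -/

import Mathlib

open Matrix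

/-- determinant of the `k × k` submatrix of `A` obtained by bordering the
upper-left `(k-1) × (k-1)` block with row `i` and column `j`. -/
def borderedMinor {R : Type*} [CommRing R] {n : ℕ} (A : Matrix (Fin n) (Fin n) R)
    (k : ℕ) (i j : Fin n) : R :=
  (Matrix.of fun p q : Fin k =>
    A (if (p : ℕ) < k - 1 then ⟨p % n, Nat.mod_lt _ i.pos⟩ else i)
      (if (q : ℕ) < k - 1 then ⟨q % n, Nat.mod_lt _ j.pos⟩ else j)).det

/-- `δ_k`: upper-left `k × k` corner minor. -/
def cornerMinor {R : Type*} [CommRing R] {n : ℕ} (A : Matrix (Fin n) (Fin n) R)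
    (k : ℕ) (hk : k ≤ n) : R :=
  (A.submatrix (Fin.castLE hk) (Fin.castLE hk)).det

theorem aux_sylv {R m k : Type*} [CommRing R] [Fintype m] [DecidableEq m] [Fintype k] [DecidableEq k]
    (F : Matrix m m R) (B : Matrix m k R) (C : Matrix k m R) (D : Matrix k k R) :
    F.det ^ Fintype.card k * (fromBlocks F B C D).det
      = F.det * (F.det • D - C * F.adjugate * B).det := by
  have h : fromBlocks (1 : Matrix m m R) 0 (-(C * F.adjugate)) (F.det • (1 : Matrix k k R))
      * fromBlocks F B C D = fromBlocks F B 0 (F.det • D - C * F.adjugate * B) := by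
    rw [fromBlocks_multiply]
    congr 1
    · simp
    · simp
    · simp [Matrix.mul_assoc, adjugate_mul]
    · simp [sub_eq_add_neg, add_comm]
  have h2 := congrArg Matrix.det h
  rw [det_mul, det_fromBlocks_zero₁₂, det_fromBlocks_zero₂₁] at h2
  simpa [det_smul] using h2

theorem aux_one {R m : Type*} [CommRing R] [Fintype m] [DecidableEq m]
    (F : Matrix m m R) (hF : F.det ∈ nonZeroDivisors R)
    (B : Matrix m (Fin 1) R) (C : Matrix (Fin 1) m R) (D : Matrix (Fin 1) (Fin 1) R) :
    (fromBlocks F B C D).det = F.det * D 0 0 - (C * F.adjugate * B) 0 0 := by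
  have h := aux_sylv F B C D
  rw [Fintype.card_fin, pow_one] at h
  have h2 := (mul_cancel_left_mem_nonZeroDivisors hF).1 h
  rw [h2]
  simp

theorem aux_border {R : Type*} [CommRing R] {n : ℕ} (A : Matrix (Fin n) (Fin n) R)
    (k : ℕ) (hk : k ≤ n) (i j : Fin n) :
    borderedMinor A (k + 1) i j =
      (A.submatrix (Sum.elim (Fin.castLE hk) (fun _ : Fin 1 => i))
        (Sum.elim (Fin.castLE hk) (fun _ : Fin 1 => j))).det := by
  unfold borderedMinor
  rw [← det_submatrix_equiv_self (finSumFinEquiv : Fin k ⊕ Fin 1 ≃ Fin (k + 1))]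
  have key : ∀ (a : Fin n) (p : Fin k ⊕ Fin 1),
      (if ((finSumFinEquiv p : Fin (k+1)) : ℕ) < k + 1 - 1 then
        (⟨(finSumFinEquiv p : Fin (k+1)) % n, Nat.mod_lt _ a.pos⟩ : Fin n) else a)
      = Sum.elim (Fin.castLE hk) (fun _ : Fin 1 => a) p := by
    rintro a (p | p)
    · have := p.isLt
      simp [Fin.ext_iff, Nat.mod_eq_of_lt (show (p : ℕ) < n by omega)]
    · simp
  congr 1
  ext p q
  simp only [submatrix_apply, of_apply]
  rw [key i p, key j q]

theorem aux_blocks {R : Type*} {m k n : Type*} (A : Matrix n n R) (e : m → n) (r c : k → n) :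
    A.submatrix (Sum.elim e r) (Sum.elim e c) =
      fromBlocks (A.submatrix e e) (A.submatrix e c) (A.submatrix r e) (A.submatrix r c) := by
  ext (i | i) (j | j) <;> rfl

theorem aux_main {R k : Type*} [CommRing R] [Fintype k] [DecidableEq k] {n s : ℕ}
    (A : Matrix (Fin n) (Fin n) R) (hs : s ≤ n)
    (hδs : cornerMinor A s hs ∈ nonZeroDivisors R) (r c : k → Fin n) :
    cornerMinor A s hs ^ Fintype.card k *
      (A.submatrix (Sum.elim (Fin.castLE hs) r) (Sum.elim (Fin.castLE hs) c)).det
    = cornerMinor A s hs * (Matrix.of fun i j => borderedMinor A (s + 1) (r i) (c j)).det := by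
  rw [aux_blocks]
  have h := aux_sylv (A.submatrix (Fin.castLE hs) (Fin.castLE hs)) (A.submatrix (Fin.castLE hs) c)
    (A.submatrix r (Fin.castLE hs)) (A.submatrix r c)
  refine h.trans ?_
  unfold cornerMinor
  congr 2
  ext i j
  rw [of_apply, aux_border A s hs, aux_blocks, aux_one _ hδs]
  simp [Matrix.mul_apply]

/-- writing `A^{(s+1)}_n = [[Ā,C̄],[B̄,D̄]]` (with `Ā = A^{(s+1)}_t`
of size `(t-s) × (t-s)`), one has
`δ_s^{t-s} • A^{(t+1)}_n = (δ_s^{t-s-1} δ_t) • D̄ − B̄ · adj(Ā) · C̄`. -/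
theorem schur_like_identity {R : Type*} [CommRing R] {n s t : ℕ}
    (A : Matrix (Fin n) (Fin n) R) (h0s : 0 < s) (hst : s < t) (htn : t < n)
    (hδs : cornerMinor A s (by omega) ∈ nonZeroDivisors R)
    (hδt : cornerMinor A t (by omega) ∈ nonZeroDivisors R) :
    let Abar : Matrix (Fin (t - s)) (Fin (t - s)) R :=
      Matrix.of fun i j => borderedMinor A (s + 1)
        ⟨s + i, by have := i.isLt; omega⟩ ⟨s + j, by have := j.isLt; omega⟩
    let Cbar : Matrix (Fin (t - s)) (Fin (n - t)) R :=
      Matrix.of fun i j => borderedMinor A (s + 1)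
        ⟨s + i, by have := i.isLt; omega⟩ ⟨t + j, by have := j.isLt; omega⟩
    let Bbar : Matrix (Fin (n - t)) (Fin (t - s)) R :=
      Matrix.of fun i j => borderedMinor A (s + 1)
        ⟨t + i, by have := i.isLt; omega⟩ ⟨s + j, by have := j.isLt; omega⟩
    let Dbar : Matrix (Fin (n - t)) (Fin (n - t)) R :=
      Matrix.of fun i j => borderedMinor A (s + 1)
        ⟨t + i, by have := i.isLt; omega⟩ ⟨t + j, by have := j.isLt; omega⟩
    let Atp1 : Matrix (Fin (n - t)) (Fin (n - t)) R :=
      Matrix.of fun i j => borderedMinor A (t + 1)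
        ⟨t + i, by have := i.isLt; omega⟩ ⟨t + j, by have := j.isLt; omega⟩
    (cornerMinor A s (by omega) ^ (t - s)) • Atp1
      = (cornerMinor A s (by omega) ^ (t - s - 1) * cornerMinor A t (by omega)) • Dbar
        - Bbar * Abar.adjugate * Cbar := by
  intro Abar Cbar Bbar Dbar Atp1
  have hs : s ≤ n := by omega
  have ht : t ≤ n := by omega
  obtain ⟨m, rfl⟩ : ∃ m, t = s + (m + 1) := ⟨t - s - 1, by omega⟩
  have hm : s + (m + 1) - s = m + 1 := by omega
  have hcard : Fintype.card (Fin (s + (m + 1) - s)) = m + 1 := by simp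
  set d := cornerMinor A s hs with hd
  let f : Fin (s + (m + 1) - s) → Fin n := fun i => ⟨s + i, by have := i.isLt; omega⟩
  let e : Fin s ⊕ Fin (s + (m + 1) - s) ≃ Fin (s + (m + 1)) :=
    finSumFinEquiv.trans (finCongr (by omega))
  have he : ∀ p, Fin.castLE ht (e p) = Sum.elim (Fin.castLE hs) f p := by
    rintro (p | p) <;> simp [e, f, Fin.ext_iff]
  have hA : Abar.det = d ^ m * cornerMinor A (s + (m + 1)) ht := by
    have h := aux_main A hs hδs f f
    have h2 : (A.submatrix (Sum.elim (Fin.castLE hs) f) (Sum.elim (Fin.castLE hs) f)).det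
        = cornerMinor A (s + (m + 1)) ht := by
      unfold cornerMinor
      rw [← det_submatrix_equiv_self e]
      congr 1
      ext p q
      simp only [submatrix_apply, he]
    rw [h2, hcard, pow_succ', mul_assoc] at h
    exact ((mul_cancel_left_mem_nonZeroDivisors hδs).1 h).symm
  have hAn : Abar.det ∈ nonZeroDivisors R := by
    rw [hA]
    exact mul_mem (pow_mem hδs _) hδt
  ext i j
  let i' : Fin n := ⟨s + (m + 1) + i, by have := i.isLt; omega⟩
  let j' : Fin n := ⟨s + (m + 1) + j, by have := j.isLt; omega⟩
  have h := aux_main A hs hδs (Sum.elim f (fun _ : Fin 1 => i')) (Sum.elim f (fun _ : Fin 1 => j'))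
  let e2 : Fin s ⊕ (Fin (s + (m + 1) - s) ⊕ Fin 1) ≃ Fin (s + (m + 1)) ⊕ Fin 1 :=
    (Equiv.sumAssoc _ _ _).symm.trans (Equiv.sumCongr e (Equiv.refl _))
  have he2 : ∀ (a : Fin n) p, Sum.elim (Fin.castLE ht) (fun _ : Fin 1 => a) (e2 p)
      = Sum.elim (Fin.castLE hs) (Sum.elim f (fun _ : Fin 1 => a)) p := by
    rintro a (p | p | p)
    · exact he (Sum.inl p)
    · exact he (Sum.inr p)
    · rfl
  have h2 : (A.submatrix (Sum.elim (Fin.castLE hs) (Sum.elim f (fun _ : Fin 1 => i')))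
      (Sum.elim (Fin.castLE hs) (Sum.elim f (fun _ : Fin 1 => j')))).det = Atp1 i j := by
    change _ = borderedMinor A (s + (m + 1) + 1) i' j'
    rw [aux_border A _ ht, ← det_submatrix_equiv_self e2]
    congr 1
    ext p q
    simp only [submatrix_apply, he2]
  have h3 : (Matrix.of fun a b => borderedMinor A (s + 1) (Sum.elim f (fun _ : Fin 1 => i') a)
      (Sum.elim f (fun _ : Fin 1 => j') b)) = fromBlocks Abar (Cbar.submatrix id (fun _ : Fin 1 => j))
        (Bbar.submatrix (fun _ : Fin 1 => i) id) (Matrix.of fun _ _ : Fin 1 => Dbar i j) := by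
    ext (a | a) (b | b) <;> rfl
  rw [h2, h3, aux_one _ hAn, Fintype.card_sum, hcard, Fintype.card_fin, pow_succ', mul_assoc] at h
  have h4 := (mul_cancel_left_mem_nonZeroDivisors hδs).1 h
  rw [hA] at h4
  simp only [Matrix.sub_apply, Matrix.smul_apply, smul_eq_mul]
  have hp : d ^ (s + (m + 1) - s) = d ^ (m + 1) := congrArg (d ^ ·) hm
  have hp2 : d ^ (s + (m + 1) - s - 1) = d ^ m := congrArg (d ^ ·) (by omega)
  rw [hp, hp2]
  refine h4.trans ?_
  simp [Matrix.mul_apply]
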